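/- Let A and B be coaugmented chain coalgebras over a commutative ring R of characteristic 2, and let h be the natural degree +1 homotopy on Ω(A⊗B). Then for every b ∈ B̄, a ∈ Ā, and every word α of letters from Ā, h[b|a|α] = [ab|α] + [a]h[b|α] + [ab_1]h[b_2|α], where Δ̄b = b_1 ⊗ b_2 in Sweedler notation. -/

import Mathlib

open scoped TensorProduct
open DirectSum

noncomputable section
namespace CJ2

/-- Cast along an equality of indices in a graded module. -/
def pcast {R : Type} [CommRing R] {A : ℕ → Type} [∀ n, AddCommGroup (A n)]
    [∀ n, Module R (A n)] {m n : ℕ} (h : m = n) : A m →ₗ[R] A n where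
  toFun x := h ▸ x
  map_add' := by subst h; intros; rfl
  map_smul' := by subst h; intros; rfl

/-- A coaugmented chain coalgebra over `R`, presented componentwise: a non-negatively
graded `R`-module `A` with differential `d` of degree `-1`, comultiplication given by
its components `comul p q : A (p+q) → A p ⊗ A q`, counit and coaugmentation, subject to
the usual axioms (coassociativity, counit laws, co-Leibniz rule, `d² = 0`). -/
structure CoalgStr (R : Type) [CommRing R] (A : ℕ → Type)
    [∀ n, AddCommGroup (A n)] [∀ n, Module R (A n)] where
  d : ∀ n, A (n+1) →ₗ[R] A n
  dd : ∀ (n : ℕ) (x : A (n+2)), d n (d (n+1) x) = 0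
  comul : ∀ p q, A (p+q) →ₗ[R] (A p ⊗[R] A q)
  counit : A 0 →ₗ[R] R
  coaug : R →ₗ[R] A 0
  counit_coaug : counit (coaug 1) = 1
  coaug_grouplike : comul 0 0 (coaug 1) = coaug 1 ⊗ₜ[R] coaug 1
  comul_counit : ∀ (n : ℕ) (x : A n),
    TensorProduct.rid R (A n) ((TensorProduct.map LinearMap.id counit) (comul n 0 x)) = x
  counit_comul : ∀ (n : ℕ) (x : A n),
    TensorProduct.lid R (A n) ((TensorProduct.map counit LinearMap.id)
      (comul 0 n (pcast (R := R) (A := A) (Nat.zero_add n).symm x))) = x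
  coassoc : ∀ (p q r : ℕ) (x : A (p+q+r)),
    TensorProduct.assoc R (A p) (A q) (A r)
        ((TensorProduct.map (comul p q) LinearMap.id) (comul (p+q) r x))
      = (TensorProduct.map LinearMap.id (comul q r)) (comul p (q+r) (pcast (R := R) (A := A) (Nat.add_assoc p q r) x))
  coleib : ∀ (p q : ℕ) (x : A (p+q+1)),
    comul p q (d (p+q) x)
      = (TensorProduct.map (d p) LinearMap.id) (comul (p+1) q (pcast (R := R) (A := A) (by omega) x))
        + ((-1 : ℤ)^p) • (TensorProduct.map LinearMap.id (d q)) (comul p (q+1) (pcast (R := R) (A := A) (by omega) x))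
  counit_d : ∀ x : A 1, counit (d 0 x) = 0

section Setup

variable {R : Type} [CommRing R]
variable (A : ℕ → Type) [∀ n, AddCommGroup (A n)] [∀ n, Module R (A n)] (CA : CoalgStr R A)

/-- The reduced part `Ā` of a coaugmented chain coalgebra:
`ker ε` in degree 0, everything in positive degree. -/
def redT : ℕ → Type
  | 0 => ↥(LinearMap.ker CA.counit)
  | n+1 => A (n+1)

instance redT.acg : ∀ n, AddCommGroup (redT A CA n)
  | 0 => inferInstanceAs (AddCommGroup ↥(LinearMap.ker CA.counit))
  | n+1 => inferInstanceAs (AddCommGroup (A (n+1)))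

instance redT.mod : ∀ n, Module R (redT A CA n)
  | 0 => inferInstanceAs (Module R ↥(LinearMap.ker CA.counit))
  | n+1 => inferInstanceAs (Module R (A (n+1)))

/-- The total module of the reduced coalgebra `Ā`. -/
abbrev Big := ⨁ n, redT A CA n

/-- Reduction `A n → Ā n`: in degree 0 it kills the coaugmentation
(`x ↦ x - η(ε x)`), in positive degrees the identity. -/
def toRed : ∀ n, A n →ₗ[R] redT A CA n
  | 0 => LinearMap.codRestrict (LinearMap.ker CA.counit)
      (LinearMap.id - CA.coaug ∘ₗ CA.counit)
      (fun x => by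
        have h1 : CA.coaug (CA.counit x) = CA.counit x • CA.coaug 1 := by
          rw [← map_smul, smul_eq_mul, mul_one]
        simp only [LinearMap.mem_ker, LinearMap.sub_apply, LinearMap.id_apply,
          LinearMap.coe_comp, Function.comp_apply, map_sub, h1, map_smul,
          CA.counit_coaug, smul_eq_mul, mul_one, sub_self])
  | n+1 => LinearMap.id

/-- The embedding of a homogeneous component of `A` into `Ā`
(killing the coaugmentation in degree 0). -/
def embT (n : ℕ) : A n →ₗ[R] Big A CA :=
  (DirectSum.lof R ℕ (redT A CA) n).comp (toRed A CA n)

/-- The degree-0 "counit" of the component `A q` (the counit for `q = 0`, else `0`). -/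
def epsAt : ∀ q, A q →ₗ[R] R
  | 0 => CA.counit
  | _+1 => 0

/-- The value of the reduced diagonal `Δ̄` on a homogeneous element,
as an element of `Ā ⊗ Ā` (the embeddings kill the primitive terms). -/
def bigDiag (p : ℕ) : A p →ₗ[R] (Big A CA ⊗[R] Big A CA) :=
  ∑ j : Fin (p+1),
    (TensorProduct.map (embT A CA j.1) (embT A CA (p - j.1))).comp
      ((CA.comul j.1 (p - j.1)).comp (pcast (R := R) (A := A) (by have := j.is_le; omega)))

end Setup

section TwoCoalgebras

variable {R : Type} [CommRing R]
variable (A : ℕ → Type) [∀ n, AddCommGroup (A n)] [∀ n, Module R (A n)] (CA : CoalgStr R A)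
variable (B : ℕ → Type) [∀ n, AddCommGroup (B n)] [∀ n, Module R (B n)] (CB : CoalgStr R B)

/-- The module of generators of `Ω (A ⊗ B)`: the reduced part
`(A ⊗ B)‾ = (Ā ⊗ B̄) ⊕ Ā ⊕ B̄`. -/
abbrev WW := (Big A CA ⊗[R] Big B CB) × Big A CA × Big B CB

/-- The underlying algebra of the cobar construction `Ω (A ⊗ B)`. -/
abbrev Om := TensorAlgebra R (WW A CA B CB)

/-- The underlying algebra of `Ω A`. -/
abbrev OmA := TensorAlgebra R (Big A CA)

/-- The underlying algebra of `Ω B`. -/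
abbrev OmB := TensorAlgebra R (Big B CB)

/-- The letter `[a]`, `a ∈ Ā`. -/
def lA : Big A CA →ₗ[R] WW A CA B CB := LinearMap.prod 0 (LinearMap.prod LinearMap.id 0)

/-- The letter `[b]`, `b ∈ B̄`. -/
def lB : Big B CB →ₗ[R] WW A CA B CB := LinearMap.prod 0 (LinearMap.prod 0 LinearMap.id)

/-- The letter `[ab]`, `a ∈ Ā`, `b ∈ B̄`. -/
def lT : (Big A CA ⊗[R] Big B CB) →ₗ[R] WW A CA B CB := LinearMap.prod LinearMap.id 0

/-- The length-one word `[a]` in `Ω (A ⊗ B)`. -/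
def genA (x : Big A CA) : Om A CA B CB := TensorAlgebra.ι R (lA A CA B CB x)

/-- The length-one word `[b]` in `Ω (A ⊗ B)`. -/
def genB (y : Big B CB) : Om A CA B CB := TensorAlgebra.ι R (lB A CA B CB y)

/-- The length-one word `[ab]` in `Ω (A ⊗ B)`. -/
def genT (t : Big A CA ⊗[R] Big B CB) : Om A CA B CB := TensorAlgebra.ι R (lT A CA B CB t)

/-- The generator of `Ω(A⊗B)` corresponding to a homogeneous element of `A_p ⊗ B_q`
(decomposed into its `[āb̄]`, `[ā]`, `[b̄]` parts). -/
def Γg (p q : ℕ) : (A p ⊗[R] B q) →ₗ[R] WW A CA B CB :=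
  LinearMap.prod (TensorProduct.map (embT A CA p) (embT B CB q))
    (LinearMap.prod
      ((embT A CA p).comp ((TensorProduct.rid R (A p)).toLinearMap.comp
        (TensorProduct.map LinearMap.id (epsAt B CB q))))
      ((embT B CB q).comp ((TensorProduct.lid R (B q)).toLinearMap.comp
        (TensorProduct.map (epsAt A CA p) LinearMap.id))))

/-- The length-one word of `Ω (A ⊗ B)` on a homogeneous element of `A_p ⊗ B_q`. -/
def genW (p q : ℕ) (z : A p ⊗[R] B q) : Om A CA B CB :=
  TensorAlgebra.ι R (Γg A CA B CB p q z)

/-- The generator values of the Milgram map: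
`[a ⊗ 1] ↦ [a] ⊗ [ ]`, `[1 ⊗ b] ↦ [ ] ⊗ [b]`, `[a ⊗ b] ↦ 0`. -/
def qgen : WW A CA B CB →ₗ[R] (OmA A CA ⊗[R] OmB B CB) :=
  ((TensorProduct.mk R (OmA A CA) (OmB B CB)).flip 1).comp
      ((TensorAlgebra.ι R).comp
        ((LinearMap.fst R (Big A CA) (Big B CB)).comp
          (LinearMap.snd R (Big A CA ⊗[R] Big B CB) (Big A CA × Big B CB))))
  + (TensorProduct.mk R (OmA A CA) (OmB B CB) 1).comp
      ((TensorAlgebra.ι R).comp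
        ((LinearMap.snd R (Big A CA) (Big B CB)).comp
          (LinearMap.snd R (Big A CA ⊗[R] Big B CB) (Big A CA × Big B CB))))

/-- The Milgram map `q : Ω (A ⊗ B) → Ω A ⊗ Ω B`. -/
def qMil : Om A CA B CB →ₐ[R] (OmA A CA ⊗[R] OmB B CB) :=
  TensorAlgebra.lift R (qgen A CA B CB)

/-- `Ω i_A : Ω A → Ω (A ⊗ B)`. -/
def OiA : OmA A CA →ₐ[R] Om A CA B CB :=
  TensorAlgebra.lift R ((TensorAlgebra.ι R).comp (lA A CA B CB))

/-- `Ω i_B : Ω B → Ω (A ⊗ B)`. -/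
def OiB : OmB B CB →ₐ[R] Om A CA B CB :=
  TensorAlgebra.lift R ((TensorAlgebra.ι R).comp (lB A CA B CB))

/-- The natural section `σ : Ω A ⊗ Ω B → Ω (A ⊗ B)`,
`σ (u ⊗ v) = Ω i_A (u) · Ω i_B (v)`. -/
def sigmaMil : (OmA A CA ⊗[R] OmB B CB) →ₗ[R] Om A CA B CB :=
  TensorProduct.lift ((LinearMap.mul R (Om A CA B CB)).compl₁₂
    (OiA A CA B CB).toLinearMap (OiB A CA B CB).toLinearMap)

/-- Bilinear multiplication helper: `(m ⊗ n) ↦ f m * g n`. -/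
def mul2 {M N P : Type} [AddCommGroup M] [Module R M] [AddCommGroup N] [Module R N]
    [Ring P] [Algebra R P] (f : M →ₗ[R] P) (g : N →ₗ[R] P) : (M ⊗[R] N) →ₗ[R] P :=
  TensorProduct.lift ((LinearMap.mul R P).compl₁₂ f g)

/-- The word in `Ω (A ⊗ B)` given by a list of homogeneous letters from `Ā`. -/
def wordA (l : List ((p : ℕ) × A p)) : Om A CA B CB :=
  (l.map fun t => genA A CA B CB (embT A CA t.1 t.2)).prod

/-- The word in `Ω (A ⊗ B)` given by a list of homogeneous letters from `B̄`. -/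
def wordB (l : List ((q : ℕ) × B q)) : Om A CA B CB :=
  (l.map fun t => genB A CA B CB (embT B CB t.1 t.2)).prod

/-- The word in `Ω (A ⊗ B)` given by a list of general homogeneous letters. -/
def wordW (l : List ((pq : ℕ × ℕ) × (A pq.1 ⊗[R] B pq.2))) : Om A CA B CB :=
  (l.map fun t => genW A CA B CB t.1.1 t.1.2 t.2).prod

/-- Parity of the cobar degree of a word of `Ā`-letters. -/
def degA (l : List ((p : ℕ) × A p)) : ℕ := (l.map fun t => t.1).sum + l.length

/-- Parity of the cobar degree of a word of general letters. -/
def degW (l : List ((pq : ℕ × ℕ) × (A pq.1 ⊗[R] B pq.2))) : ℕ :=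
  (l.map fun t => t.1.1 + t.1.2).sum + l.length

/-- The Sweedler-type operation `(b₁ ⊗ b₂) ↦ h([b₁ | α]) · [a b₂]`. -/
def sweedC (h : Om A CA B CB →ₗ[R] Om A CA B CB) (α : List ((p : ℕ) × A p))
    (x : Big A CA) : (Big B CB ⊗[R] Big B CB) →ₗ[R] Om A CA B CB :=
  TensorProduct.lift ((LinearMap.mul R (Om A CA B CB)).compl₁₂
    (h ∘ₗ (LinearMap.mulRight R (wordA A CA B CB α)) ∘ₗ (TensorAlgebra.ι R) ∘ₗ lB A CA B CB)
    ((TensorAlgebra.ι R) ∘ₗ (lT A CA B CB) ∘ₗ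
      (TensorProduct.mk R (Big A CA) (Big B CB) x)))

/-- The Sweedler-type operation `(b₁ ⊗ b₂) ↦ [a b₁] · h([b₂ | α])`. -/
def sweedC2 (h : Om A CA B CB →ₗ[R] Om A CA B CB) (α : List ((p : ℕ) × A p))
    (x : Big A CA) : (Big B CB ⊗[R] Big B CB) →ₗ[R] Om A CA B CB :=
  TensorProduct.lift ((LinearMap.mul R (Om A CA B CB)).compl₁₂
    ((TensorAlgebra.ι R) ∘ₗ (lT A CA B CB) ∘ₗ
      (TensorProduct.mk R (Big A CA) (Big B CB) x))
    (h ∘ₗ (LinearMap.mulRight R (wordA A CA B CB α)) ∘ₗ (TensorAlgebra.ι R) ∘ₗ lB A CA B CB))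

end TwoCoalgebras

section CobarValues

variable {R : Type} [CommRing R]
variable (A : ℕ → Type) [∀ n, AddCommGroup (A n)] [∀ n, Module R (A n)] (CA : CoalgStr R A)

/-- The linear part `[dx]` of the cobar differential of `Ω A` on a generator. -/
def linAA : ∀ p, A p →ₗ[R] OmA A CA
  | 0 => 0
  | p+1 => (TensorAlgebra.ι R).comp ((embT A CA p).comp (CA.d p))

/-- The quadratic part `∑ (-1)^{deg x₍₁₎} [x₍₁₎|x₍₂₎]` of the cobar differential of
`Ω A` on a generator. -/
def quadAA (p : ℕ) : A p →ₗ[R] OmA A CA :=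
  ∑ j : Fin (p+1), ((-1 : ℤ)^(j.1)) •
    ((mul2 (TensorAlgebra.ι R) (TensorAlgebra.ι R)).comp
      ((TensorProduct.map (embT A CA j.1) (embT A CA (p - j.1))).comp
        ((CA.comul j.1 (p - j.1)).comp (pcast (R := R) (A := A) (by have := j.is_le; omega)))))

/-- The value of the cobar differential of `Ω A` on the generator given by a homogeneous
element: `d_Ω [x] = -[dx] + ∑ (-1)^{deg x₍₁₎} [x₍₁₎|x₍₂₎]`. -/
def dvalAA (p : ℕ) : A p →ₗ[R] OmA A CA := - linAA A CA p + quadAA A CA p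

/-- The word of `Ω A` given by a list of homogeneous letters. -/
def wordAlg (l : List ((p : ℕ) × A p)) : OmA A CA :=
  (l.map fun t => TensorAlgebra.ι R (embT A CA t.1 t.2)).prod

end CobarValues

section CobarValuesT

variable {R : Type} [CommRing R]
variable (A : ℕ → Type) [∀ n, AddCommGroup (A n)] [∀ n, Module R (A n)] (CA : CoalgStr R A)
variable (B : ℕ → Type) [∀ n, AddCommGroup (B n)] [∀ n, Module R (B n)] (CB : CoalgStr R B)

/-- `[(da) b]` : the `A`-part of the linear term of the cobar differential of
`Ω (A ⊗ B)` on a generator of bidegree `(p,q)`. -/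
def linT1 : ∀ (p q : ℕ), (A p ⊗[R] B q) →ₗ[R] Om A CA B CB
  | 0, _ => 0
  | p+1, q => ((TensorAlgebra.ι R).comp (Γg A CA B CB p q)).comp
      (TensorProduct.map (CA.d p) LinearMap.id)

/-- `(-1)^p [a (db)]` : the `B`-part of the linear term. -/
def linT2 : ∀ (p q : ℕ), (A p ⊗[R] B q) →ₗ[R] Om A CA B CB
  | _, 0 => 0
  | p, q+1 => ((-1 : ℤ)^p) • (((TensorAlgebra.ι R).comp (Γg A CA B CB p q)).comp
      (TensorProduct.map LinearMap.id (CB.d q)))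

/-- The quadratic (Künneth) part of the cobar differential of `Ω (A ⊗ B)` on a
generator of bidegree `(p,q)`:
`∑ (-1)^{q₁p₂} (-1)^{p₁+q₁} [a₍₁₎b₍₁₎ | a₍₂₎b₍₂₎]` (primitive terms being killed by
the reduction embeddings). -/
def quadT (p q : ℕ) : (A p ⊗[R] B q) →ₗ[R] Om A CA B CB :=
  ∑ j : Fin (p+1), ∑ k : Fin (q+1),
    ((-1 : ℤ)^(k.1 * (p - j.1) + j.1 + k.1)) •
      ((mul2 ((TensorAlgebra.ι R).comp (Γg A CA B CB j.1 k.1))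
             ((TensorAlgebra.ι R).comp (Γg A CA B CB (p - j.1) (q - k.1)))).comp
        ((TensorProduct.tensorTensorTensorComm R (A j.1) (A (p - j.1)) (B k.1) (B (q - k.1))).toLinearMap.comp
          (TensorProduct.map
            ((CA.comul j.1 (p - j.1)).comp (pcast (R := R) (A := A) (by have := j.is_le; omega)))
            ((CB.comul k.1 (q - k.1)).comp (pcast (R := R) (A := B) (by have := k.is_le; omega))))))

/-- The value of the cobar differential of `Ω (A ⊗ B)` on the generator given by a
homogeneous element of `A_p ⊗ B_q`:
`d_Ω [w] = -[d_{A⊗B} w] + ∑ (-1)^{deg w₍₁₎} [w₍₁₎ | w₍₂₎]`. -/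
def dvalT (p q : ℕ) : (A p ⊗[R] B q) →ₗ[R] Om A CA B CB :=
  - linT1 A CA B CB p q - linT2 A CA B CB p q + quadT A CA B CB p q

end CobarValuesT

section ReducedDiagonal

variable {R : Type} [CommRing R]
variable (A : ℕ → Type) [∀ n, AddCommGroup (A n)] [∀ n, Module R (A n)] (CA : CoalgStr R A)

/-- The inclusion `Ā n → A n`. -/
def redIncl : ∀ n, redT A CA n →ₗ[R] A n
  | 0 => (LinearMap.ker CA.counit).subtype
  | _ + 1 => LinearMap.id

theorem toRed_redIncl (n : ℕ) (y : redT A CA n) : toRed A CA n (redIncl A CA n y) = y := by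
  cases n with
  | zero =>
    apply Subtype.ext
    have hy : CA.counit y.1 = 0 := y.2
    change y.1 - CA.coaug (CA.counit y.1) = y.1
    rw [hy, map_zero, sub_zero]
  | succ n => rfl

theorem embT_coaug : embT A CA 0 (CA.coaug 1) = 0 := by
  have : toRed A CA 0 (CA.coaug 1) = 0 := by
    apply Subtype.ext
    change CA.coaug 1 - CA.coaug (CA.counit (CA.coaug 1)) = 0
    rw [CA.counit_coaug, sub_self]
  simp [embT, this]

theorem bigDiag_coaug : bigDiag A CA 0 (CA.coaug 1) = 0 := by
  have : CA.comul 0 0 (CA.coaug 1) = _ := CA.coaug_grouplike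
  rw [bigDiag, Fin.sum_univ_one]
  change (TensorProduct.map (embT A CA 0) (embT A CA 0)) (CA.comul 0 0 (CA.coaug 1)) = 0
  rw [this, TensorProduct.map_tmul, embT_coaug, TensorProduct.zero_tmul]

theorem bigDiag_redIncl_toRed (n : ℕ) (x : A n) :
    bigDiag A CA n (redIncl A CA n (toRed A CA n x)) = bigDiag A CA n x := by
  cases n with
  | zero =>
    change bigDiag A CA 0 (x - CA.coaug (CA.counit x)) = _
    have h1 : CA.coaug (CA.counit x) = CA.counit x • CA.coaug 1 := by
      rw [← map_smul, smul_eq_mul, mul_one]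
    rw [map_sub, h1, map_smul, bigDiag_coaug, smul_zero, sub_zero]
  | succ n => rfl

/-- The reduced diagonal `Δ̄ : Ā → Ā ⊗ Ā`. -/
def redDiag : Big A CA →ₗ[R] Big A CA ⊗[R] Big A CA :=
  DirectSum.toModule R ℕ _ fun n => (bigDiag A CA n).comp (redIncl A CA n)

theorem redDiag_embT (n : ℕ) (x : A n) :
    redDiag A CA (embT A CA n x) = bigDiag A CA n x := by
  simp [redDiag, embT, bigDiag_redIncl_toRed]

theorem redDiag_comp_embT (n : ℕ) :
    (redDiag A CA).comp (embT A CA n) = bigDiag A CA n :=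
  LinearMap.ext (redDiag_embT A CA n)

theorem Big.induction_embT {P : Big A CA → Prop} (x : Big A CA) (zero : P 0)
    (emb : ∀ n a, P (embT A CA n a)) (add : ∀ y z, P y → P z → P (y + z)) : P x := by
  induction x using DirectSum.induction_on with
  | zero => exact zero
  | of n y =>
    have h := emb n (redIncl A CA n y)
    rwa [embT, LinearMap.comp_apply, toRed_redIncl] at h
  | add y z hy hz => exact add y z hy hz

/-- The `(i, j)` component of the comultiplication on `A n`, zero unless `i + j = n`. -/
def comulAt (n i j : ℕ) : A n →ₗ[R] A i ⊗[R] A j :=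
  if h : i + j = n then (CA.comul i j).comp (pcast h.symm) else 0

/-- The `(i, j)` component of the reduced diagonal on `A n`. -/
def diagAt (n i j : ℕ) : A n →ₗ[R] Big A CA ⊗[R] Big A CA :=
  (TensorProduct.map (embT A CA i) (embT A CA j)).comp (comulAt A CA n i j)

theorem bigDiag_eq_sum_diagAt (n : ℕ) :
    bigDiag A CA n = ∑ ij ∈ Finset.HasAntidiagonal.antidiagonal n, diagAt A CA n ij.1 ij.2 := by
  rw [Finset.Nat.sum_antidiagonal_eq_sum_range_succ (fun i j => diagAt A CA n i j),
    Finset.sum_range]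
  refine Finset.sum_congr rfl fun j _ => ?_
  rw [diagAt, comulAt, dif_pos (by have := j.is_le; omega)]

theorem assoc_diagAt {i j r n m q : ℕ} (hn : i + j = n) (hm : j + r = m) (hq : n + r = q)
    (x : A q) :
    TensorProduct.assoc R _ _ _
        (TensorProduct.map (diagAt A CA n i j) (embT A CA r) (comulAt A CA q n r x))
      = TensorProduct.map (embT A CA i) (diagAt A CA m j r) (comulAt A CA q i m x) := by
  subst hn hm hq
  have hL : ∀ z : A (i + j) ⊗[R] A r,
      TensorProduct.assoc R _ _ _ (TensorProduct.map (diagAt A CA (i + j) i j) (embT A CA r) z)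
        = TensorProduct.map (embT A CA i) (TensorProduct.map (embT A CA j) (embT A CA r))
          (TensorProduct.assoc R _ _ _ (TensorProduct.map (CA.comul i j) LinearMap.id z)) := by
    intro z
    rw [TensorProduct.map_map_assoc, ← LinearMap.comp_apply (TensorProduct.map _ _),
      ← TensorProduct.map_comp, diagAt, comulAt, dif_pos rfl]
    rfl
  have hR : diagAt A CA (j + r) j r
      = (TensorProduct.map (embT A CA j) (embT A CA r)).comp (CA.comul j r) := by
    rw [diagAt, comulAt, dif_pos rfl]
    rfl
  have hx : comulAt A CA (i + j + r) (i + j) r = CA.comul (i + j) r := by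
    rw [comulAt, dif_pos rfl]
    rfl
  rw [hL, hx, CA.coassoc, ← LinearMap.comp_apply (TensorProduct.map _ _),
    ← TensorProduct.map_comp, hR, comulAt, dif_pos (Nat.add_assoc i j r).symm]
  rfl

theorem redDiag_coassoc (y : Big A CA) :
    TensorProduct.assoc R _ _ _
        (TensorProduct.map (redDiag A CA) LinearMap.id (redDiag A CA y))
      = TensorProduct.map LinearMap.id (redDiag A CA) (redDiag A CA y) := by
  induction y using Big.induction_embT with
  | zero => simp
  | add y z hy hz => simp only [map_add, hy, hz]
  | emb q x =>
    rw [redDiag_embT, bigDiag_eq_sum_diagAt]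
    simp only [LinearMap.sum_apply, map_sum]
    have hL : ∀ n r, TensorProduct.map (redDiag A CA) LinearMap.id (diagAt A CA q n r x)
        = ∑ ij ∈ Finset.HasAntidiagonal.antidiagonal n,
          TensorProduct.map (diagAt A CA n ij.1 ij.2) (embT A CA r) (comulAt A CA q n r x) := by
      intro n r
      rw [diagAt, LinearMap.comp_apply, ← LinearMap.comp_apply (TensorProduct.map _ _),
        ← TensorProduct.map_comp, redDiag_comp_embT, LinearMap.id_comp, bigDiag_eq_sum_diagAt,
        ← LinearMap.sum_apply]
      congr 1
      ext u v
      simp [TensorProduct.sum_tmul]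
    have hR : ∀ i m, TensorProduct.map LinearMap.id (redDiag A CA) (diagAt A CA q i m x)
        = ∑ jr ∈ Finset.HasAntidiagonal.antidiagonal m,
          TensorProduct.map (embT A CA i) (diagAt A CA m jr.1 jr.2) (comulAt A CA q i m x) := by
      intro i m
      rw [diagAt, LinearMap.comp_apply, ← LinearMap.comp_apply (TensorProduct.map _ _),
        ← TensorProduct.map_comp, redDiag_comp_embT, LinearMap.id_comp, bigDiag_eq_sum_diagAt,
        ← LinearMap.sum_apply]
      congr 1
      ext u v
      simp [TensorProduct.tmul_sum]
    simp only [hL, hR, map_sum]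
    rw [Finset.sum_sigma', Finset.sum_sigma']
    refine Finset.sum_bij'
      (fun s _ => ⟨(s.2.1, s.2.2 + s.1.2), (s.2.2, s.1.2)⟩)
      (fun s _ => ⟨(s.1.1 + s.2.1, s.2.2), (s.1.1, s.2.1)⟩) ?_ ?_ ?_ ?_ ?_
    all_goals rintro ⟨⟨n, r⟩, ⟨i, j⟩⟩ hs
    all_goals simp only [Finset.mem_sigma, Finset.HasAntidiagonal.mem_antidiagonal, and_true] at hs ⊢
    · omega
    · omega
    · rw [hs.2]
    · rw [hs.2]
    · exact assoc_diagAt A CA hs.2 rfl hs.1 x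

end ReducedDiagonal

section BilinearProducts

variable {R M N L P : Type} [CommRing R] [AddCommGroup M] [Module R M] [AddCommGroup N]
  [Module R N] [AddCommGroup L] [Module R L] [Ring P] [Algebra R P]

@[simp]
theorem mul2_tmul (f : M →ₗ[R] P) (g : N →ₗ[R] P) (m : M) (n : N) :
    mul2 f g (m ⊗ₜ[R] n) = f m * g n := rfl

@[simp]
theorem mul2_zero_left (g : N →ₗ[R] P) : mul2 (0 : M →ₗ[R] P) g = 0 := by
  ext; simp

@[simp]
theorem mul2_zero_right (f : M →ₗ[R] P) : mul2 f (0 : N →ₗ[R] P) = 0 := by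
  ext; simp

theorem mul2_add_left (f f' : M →ₗ[R] P) (g : N →ₗ[R] P) :
    mul2 (f + f') g = mul2 f g + mul2 f' g := by
  ext; simp [add_mul]

theorem mul2_add_right (f : M →ₗ[R] P) (g g' : N →ₗ[R] P) :
    mul2 f (g + g') = mul2 f g + mul2 f g' := by
  ext; simp [mul_add]

theorem mul2_mulLeft_comp (c : P) (f : M →ₗ[R] P) (g : N →ₗ[R] P) (z : M ⊗[R] N) :
    mul2 (LinearMap.mulLeft R c ∘ₗ f) g z = c * mul2 f g z := by
  have : mul2 (LinearMap.mulLeft R c ∘ₗ f) g = LinearMap.mulLeft R c ∘ₗ mul2 f g := by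
    ext; simp [mul_assoc]
  rw [this]; rfl

theorem mul2_mulRight_comp (c : P) (f : M →ₗ[R] P) (g : N →ₗ[R] P) (z : M ⊗[R] N) :
    mul2 f (LinearMap.mulRight R c ∘ₗ g) z = mul2 f g z * c := by
  have : mul2 f (LinearMap.mulRight R c ∘ₗ g) = LinearMap.mulRight R c ∘ₗ mul2 f g := by
    ext; simp [mul_assoc]
  rw [this]; rfl

theorem mul2_mulRight_mulLeft (c : P) (f : M →ₗ[R] P) (g : N →ₗ[R] P) :
    mul2 (LinearMap.mulRight R c ∘ₗ f) g = mul2 f (LinearMap.mulLeft R c ∘ₗ g) := by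
  ext; simp [mul_assoc]

theorem mul2_assoc (f : M →ₗ[R] P) (g : N →ₗ[R] P) (k : L →ₗ[R] P) (z : (M ⊗[R] N) ⊗[R] L) :
    mul2 (mul2 f g) k z = mul2 f (mul2 g k) (TensorProduct.assoc R M N L z) := by
  have : mul2 (mul2 f g) k
      = mul2 f (mul2 g k) ∘ₗ (TensorProduct.assoc R M N L).toLinearMap := by
    ext; simp [mul_assoc]
  rw [this]; rfl

end BilinearProducts

theorem mul2_redDiag_assoc {R : Type} [CommRing R] (B : ℕ → Type) [∀ n, AddCommGroup (B n)]
    [∀ n, Module R (B n)] (CB : CoalgStr R B) {P : Type} [Ring P] [Algebra R P]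
    (f g k : Big B CB →ₗ[R] P) (y : Big B CB) :
    mul2 (mul2 f g ∘ₗ redDiag B CB) k (redDiag B CB y)
      = mul2 f (mul2 g k ∘ₗ redDiag B CB) (redDiag B CB y) := by
  have hl : mul2 (mul2 f g ∘ₗ redDiag B CB) k
      = mul2 (mul2 f g) k ∘ₗ TensorProduct.map (redDiag B CB) LinearMap.id := by
    apply TensorProduct.ext'
    intros
    rfl
  have hr : mul2 f (mul2 g k ∘ₗ redDiag B CB)
      = mul2 f (mul2 g k) ∘ₗ TensorProduct.map LinearMap.id (redDiag B CB) := by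
    apply TensorProduct.ext'
    intros
    rfl
  rw [hl, hr, LinearMap.comp_apply, LinearMap.comp_apply, mul2_assoc, redDiag_coassoc]

section Switch

variable {R : Type} [CommRing R]
variable (A : ℕ → Type) [∀ n, AddCommGroup (A n)] [∀ n, Module R (A n)] (CA : CoalgStr R A)
variable (B : ℕ → Type) [∀ n, AddCommGroup (B n)] [∀ n, Module R (B n)] (CB : CoalgStr R B)

/-- The map `b ↦ [ab]`. -/
def letterT (x : Big A CA) : Big B CB →ₗ[R] Om A CA B CB :=
  TensorAlgebra.ι R ∘ₗ lT A CA B CB ∘ₗ TensorProduct.mk R (Big A CA) (Big B CB) x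

/-- The map `b ↦ h[b | u]`. -/
def applyB (h : Om A CA B CB →ₗ[R] Om A CA B CB) (u : Om A CA B CB) :
    Big B CB →ₗ[R] Om A CA B CB :=
  h ∘ₗ LinearMap.mulRight R u ∘ₗ TensorAlgebra.ι R ∘ₗ lB A CA B CB

theorem applyB_apply (h : Om A CA B CB →ₗ[R] Om A CA B CB) (u : Om A CA B CB) (y : Big B CB) :
    applyB A CA B CB h u y = h (genB A CA B CB y * u) := rfl

theorem letterT_add (x x' : Big A CA) :
    letterT A CA B CB (x + x') = letterT A CA B CB x + letterT A CA B CB x' := by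
  simp [letterT, LinearMap.comp_add]

theorem genA_add (x x' : Big A CA) :
    genA A CA B CB (x + x') = genA A CA B CB x + genA A CA B CB x' := by
  simp [genA]

theorem wordA_cons (t : (p : ℕ) × A p) (α : List ((p : ℕ) × A p)) :
    wordA A CA B CB (t :: α) = genA A CA B CB (embT A CA t.1 t.2) * wordA A CA B CB α := by
  simp [wordA]

theorem wordA_concat (α : List ((p : ℕ) × A p)) (t : (p : ℕ) × A p) :
    wordA A CA B CB (α ++ [t]) = wordA A CA B CB α * genA A CA B CB (embT A CA t.1 t.2) := by
  simp [wordA]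

/-- The recursion for `h[b | α | a]`, for all `b ∈ B̄`, with `Δ̄` as a map on `B̄`. -/
theorem applyB_wordA_mul_genA (h : Om A CA B CB →ₗ[R] Om A CA B CB)
    (hRec : ∀ (q : ℕ) (b : B q) (α : List ((p : ℕ) × A p)) (x : Big A CA),
      h (genB A CA B CB (embT B CB q b) * wordA A CA B CB α * genA A CA B CB x)
        = wordA A CA B CB α * genT A CA B CB (x ⊗ₜ[R] embT B CB q b)
          + h (genB A CA B CB (embT B CB q b) * wordA A CA B CB α) * genA A CA B CB x
          + sweedC A CA B CB h α x (bigDiag B CB q b))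
    (α : List ((p : ℕ) × A p)) (x : Big A CA) :
    applyB A CA B CB h (wordA A CA B CB α * genA A CA B CB x)
      = LinearMap.mulLeft R (wordA A CA B CB α) ∘ₗ letterT A CA B CB x
        + LinearMap.mulRight R (genA A CA B CB x) ∘ₗ applyB A CA B CB h (wordA A CA B CB α)
        + mul2 (applyB A CA B CB h (wordA A CA B CB α)) (letterT A CA B CB x)
            ∘ₗ redDiag B CB := by
  refine LinearMap.ext fun y => ?_
  induction y using Big.induction_embT with
  | zero => simp only [map_zero]
  | add y z hy hz => rw [map_add, map_add, hy, hz]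
  | emb q b =>
    simp only [LinearMap.add_apply, LinearMap.comp_apply, redDiag_embT]
    rw [applyB_apply, ← mul_assoc, hRec]
    rfl

/-- The switch formula for a homogeneous letter, for all `b ∈ B̄`. -/
theorem applyB_genA_mul_wordA (h : Om A CA B CB →ₗ[R] Om A CA B CB)
    (hB : applyB A CA B CB h 1 = 0)
    (hRec : ∀ (α : List ((p : ℕ) × A p)) (x : Big A CA),
      applyB A CA B CB h (wordA A CA B CB α * genA A CA B CB x)
        = LinearMap.mulLeft R (wordA A CA B CB α) ∘ₗ letterT A CA B CB x
          + LinearMap.mulRight R (genA A CA B CB x) ∘ₗ applyB A CA B CB h (wordA A CA B CB α)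
          + mul2 (applyB A CA B CB h (wordA A CA B CB α)) (letterT A CA B CB x)
              ∘ₗ redDiag B CB)
    (p : ℕ) (a : A p) (α : List ((p : ℕ) × A p)) :
    applyB A CA B CB h (genA A CA B CB (embT A CA p a) * wordA A CA B CB α)
      = LinearMap.mulRight R (wordA A CA B CB α) ∘ₗ letterT A CA B CB (embT A CA p a)
        + LinearMap.mulLeft R (genA A CA B CB (embT A CA p a)) ∘ₗ
            applyB A CA B CB h (wordA A CA B CB α)
        + mul2 (letterT A CA B CB (embT A CA p a)) (applyB A CA B CB h (wordA A CA B CB α))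
            ∘ₗ redDiag B CB := by
  induction α using List.reverseRecOn with
  | nil =>
    have h0 := hRec [] (embT A CA p a)
    have hw : wordA A CA B CB [] = 1 := rfl
    rw [hw, one_mul, hB, mul2_zero_left] at h0
    rw [hw, mul_one, hB, mul2_zero_right, h0]
    simp
  | append_singleton α t ih =>
    have hcons := hRec (⟨p, a⟩ :: α) (embT A CA t.1 t.2)
    rw [wordA_cons, mul_assoc] at hcons
    rw [wordA_concat, hcons, hRec, ih]
    refine LinearMap.ext fun y => ?_
    have hassoc := mul2_redDiag_assoc B CB (letterT A CA B CB (embT A CA p a))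
      (applyB A CA B CB h (wordA A CA B CB α)) (letterT A CA B CB (embT A CA t.1 t.2)) y
    simp only [mul2_add_left, mul2_add_right, LinearMap.add_apply, LinearMap.comp_apply,
      mul2_mulRight_mulLeft, mul2_mulLeft_comp, mul2_mulRight_comp, hassoc,
      LinearMap.mulLeft_apply, LinearMap.mulRight_apply, add_mul, mul_add, mul_assoc]
    abel

end Switch

/-- Let `A`, `B` be coaugmented chain coalgebras over a commutative
ring `R` of characteristic 2, and `h` the natural degree `+1` homotopy on `Ω (A ⊗ B)`.
Then for every `b ∈ B̄`, `a ∈ Ā` and every word `α` of letters from `Ā`,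
`h[b|a|α] = [ab|α] + [a] h[b|α] + [ab₁] h[b₂|α]`  (Sweedler notation `Δ̄ b = b₁ ⊗ b₂`). -/
theorem homotopy_switch_lemma
    (R : Type) [CommRing R] [CharP R 2]
    (A : ℕ → Type) [∀ n, AddCommGroup (A n)] [∀ n, Module R (A n)] (CA : CoalgStr R A)
    (B : ℕ → Type) [∀ n, AddCommGroup (B n)] [∀ n, Module R (B n)] (CB : CoalgStr R B)
    -- the natural homotopy h, characterized by its defining recursion (mod 2)
    (h : Om A CA B CB →ₗ[R] Om A CA B CB)
    (hh1 : h 1 = 0)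
    (hhEnd : ∀ (u : Om A CA B CB) (t : Big A CA ⊗[R] Big B CB), h (u * genT A CA B CB t) = 0)
    (hhBase : ∀ (p q : ℕ) (a : A p) (b : B q),
      h (genB A CA B CB (embT B CB q b) * genA A CA B CB (embT A CA p a))
        = genT A CA B CB (embT A CA p a ⊗ₜ[R] embT B CB q b))
    (hhRec1 : ∀ (q : ℕ) (b : B q) (α : List ((p : ℕ) × A p)) (x : Big A CA),
      h (genB A CA B CB (embT B CB q b) * wordA A CA B CB α * genA A CA B CB x)
        = wordA A CA B CB α * genT A CA B CB (x ⊗ₜ[R] embT B CB q b)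
          + h (genB A CA B CB (embT B CB q b) * wordA A CA B CB α) * genA A CA B CB x
          + sweedC A CA B CB h α x (bigDiag B CB q b))
    (hhRec2 : ∀ (ω : Om A CA B CB) (q : ℕ) (b : B q) (α : List ((p : ℕ) × A p)),
      α ≠ [] → ∀ β : List ((r : ℕ) × B r),
      h (ω * genB A CA B CB (embT B CB q b) * wordA A CA B CB α * wordB A CA B CB β)
        = ω * h (genB A CA B CB (embT B CB q b) * wordA A CA B CB α) * wordB A CA B CB β
          + h (ω * wordA A CA B CB α * genB A CA B CB (embT B CB q b) * wordB A CA B CB β))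
    (hhZero1 : ∀ (α : List ((p : ℕ) × A p)) (β : List ((r : ℕ) × B r)),
      h (wordA A CA B CB α * wordB A CA B CB β) = 0)
    (hhZero2 : ∀ (ω : Om A CA B CB) (t : Big A CA ⊗[R] Big B CB)
        (α : List ((p : ℕ) × A p)) (β : List ((r : ℕ) × B r)),
      h (ω * genT A CA B CB t * wordA A CA B CB α * wordB A CA B CB β) = 0)
    : ∀ (q : ℕ) (b : B q) (x : Big A CA) (α : List ((p : ℕ) × A p)),
      h (genB A CA B CB (embT B CB q b) * genA A CA B CB x * wordA A CA B CB α)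
      = genT A CA B CB (x ⊗ₜ[R] embT B CB q b) * wordA A CA B CB α
        + genA A CA B CB x * h (genB A CA B CB (embT B CB q b) * wordA A CA B CB α)
        + sweedC2 A CA B CB h α x (bigDiag B CB q b) := by
  intro q b x α
  have hB : applyB A CA B CB h 1 = 0 := by
    refine LinearMap.ext fun y => ?_
    induction y using Big.induction_embT with
    | zero => simp only [map_zero]
    | add y z hy hz => rw [map_add, map_add, hy, hz]
    | emb q b => simpa [applyB_apply, wordA, wordB] using hhZero1 [] [⟨q, b⟩]
  have key : applyB A CA B CB h (genA A CA B CB x * wordA A CA B CB α)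
      = LinearMap.mulRight R (wordA A CA B CB α) ∘ₗ letterT A CA B CB x
        + LinearMap.mulLeft R (genA A CA B CB x) ∘ₗ applyB A CA B CB h (wordA A CA B CB α)
        + mul2 (letterT A CA B CB x) (applyB A CA B CB h (wordA A CA B CB α))
            ∘ₗ redDiag B CB := by
    induction x using Big.induction_embT with
    | zero =>
      have hg : genA A CA B CB 0 = 0 := by simp [genA]
      have ha : applyB A CA B CB h 0 = 0 := LinearMap.ext fun y => by simp [applyB_apply]
      have ht : letterT A CA B CB 0 = 0 := by simp [letterT]
      simp [hg, ha, ht]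
    | add x z hx hz =>
      have hadd : applyB A CA B CB h ((genA A CA B CB x + genA A CA B CB z) * wordA A CA B CB α)
          = applyB A CA B CB h (genA A CA B CB x * wordA A CA B CB α)
            + applyB A CA B CB h (genA A CA B CB z * wordA A CA B CB α) := by
        refine LinearMap.ext fun y => ?_
        simp only [applyB_apply, LinearMap.add_apply, add_mul, mul_add, map_add]
      rw [genA_add, hadd, hx, hz, letterT_add, mul2_add_left]
      refine LinearMap.ext fun y => ?_
      simp only [LinearMap.add_apply, LinearMap.comp_apply, LinearMap.mulLeft_apply,
        LinearMap.mulRight_apply, add_mul]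
      abel
    | emb p a =>
      exact applyB_genA_mul_wordA A CA B CB h hB
        (applyB_wordA_mul_genA A CA B CB h hhRec1) p a α
  have hb := LinearMap.congr_fun key (embT B CB q b)
  simp only [LinearMap.add_apply, LinearMap.comp_apply, redDiag_embT] at hb
  rw [applyB_apply, ← mul_assoc] at hb
  exact hb

end CJ2
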